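/- Fix an integer r ≥ 2 and let t = t(r) = ⌈√(2r + 1/4) − 1/2⌉. Then for every integer s ≥ 1 and n = ts, one has (r/t)·n + (r − t) ≤ NGΣ↑_η(r;n). -/

import Mathlib

open scoped Classical

namespace NG

/-- The set of earlier neighbors (back-neighborhood) of vertex `j` in `H`,
with respect to the natural order on `Fin N`. -/
noncomputable def backNbhd {N : ℕ} (H : SimpleGraph (Fin N)) (j : Fin N) :
    Finset (Fin N) :=
  Finset.univ.filter (fun i => (i : ℕ) < (j : ℕ) ∧ H.Adj i j)

/-- The degree of `u` in the subgraph of `H` induced on the first `j` vertices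
(the "stage `j`" graph of the construction). -/
noncomputable def stageDeg {N : ℕ} (H : SimpleGraph (Fin N)) (j : ℕ) (u : Fin N) : ℕ :=
  (Finset.univ.filter (fun w : Fin N => (w : ℕ) < j ∧ (u : ℕ) < j ∧ H.Adj u w)).card

/-- `H` on `Fin N` is a `k`-tree, built in the natural vertex order: the first
`k+1` vertices form a clique, and every later vertex is joined exactly to the
vertices of an existing `k`-clique. -/
def IsKTreeOrd (k : ℕ) (N : ℕ) (H : SimpleGraph (Fin N)) : Prop :=
  1 ≤ k ∧ k + 1 ≤ N ∧
  (∀ i j : Fin N, (i : ℕ) < (j : ℕ) → (j : ℕ) ≤ k → H.Adj i j) ∧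
  (∀ j : Fin N, k < (j : ℕ) →
    (backNbhd H j).card = k ∧ H.IsClique (backNbhd H j : Set (Fin N)))

/-- A linear `k`-tree: a `k`-tree in which each new vertex (after the first added
one) is joined to a `k`-clique containing the vertex added at the previous step. -/
def IsLinearKTreeOrd (k : ℕ) (N : ℕ) (H : SimpleGraph (Fin N)) : Prop :=
  IsKTreeOrd k N H ∧
  ∀ i j : Fin N, (i : ℕ) + 1 = (j : ℕ) → k + 1 < (j : ℕ) → i ∈ backNbhd H j

/-- A `k`-caterpillar: a `k`-tree in which each new vertex (after the first added
one) is joined to a `k`-clique contained in the maximal `(k+1)`-clique created at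
the previous stage. -/
def IsCaterpillarOrd (k : ℕ) (N : ℕ) (H : SimpleGraph (Fin N)) : Prop :=
  IsKTreeOrd k N H ∧
  ∀ i j : Fin N, (i : ℕ) + 1 = (j : ℕ) → k + 1 < (j : ℕ) →
    backNbhd H j ⊆ insert i (backNbhd H i)

/-- A two-sided `k`-tree: a `k`-tree in which each new vertex is joined to a
`k`-clique that either contains a vertex of degree `k` (at that stage) or equals
the `k`-clique to which some previously added vertex was joined. -/
def IsTwoSidedKTreeOrd (k : ℕ) (N : ℕ) (H : SimpleGraph (Fin N)) : Prop :=
  IsKTreeOrd k N H ∧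
  ∀ j : Fin N, k < (j : ℕ) →
    ((∃ u ∈ backNbhd H j, stageDeg H (j : ℕ) u = k) ∨
     (∃ i : Fin N, k < (i : ℕ) ∧ (i : ℕ) < (j : ℕ) ∧ backNbhd H i = backNbhd H j))

/-- The least `k` such that `G` embeds as a subgraph into some graph in the
class `P k`; an edgeless graph gets the value `0`. -/
noncomputable def widthParam (P : ℕ → (N : ℕ) → SimpleGraph (Fin N) → Prop)
    (n : ℕ) (G : SimpleGraph (Fin n)) : ℕ :=
  if G = ⊥ then 0
  else sInf {k | ∃ (N : ℕ) (H : SimpleGraph (Fin N)) (f : Fin n ↪ Fin N),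
    P k N H ∧ ∀ u v : Fin n, G.Adj u v → H.Adj (f u) (f v)}

/-- Tree-width: the least `k` such that `G` is a subgraph of a `k`-tree. -/
noncomputable def treewidth (n : ℕ) (G : SimpleGraph (Fin n)) : ℕ :=
  widthParam IsKTreeOrd n G

/-- Largeur d'arborescence: the least `k` such that `G` is a subgraph of a
two-sided `k`-tree. -/
noncomputable def la (n : ℕ) (G : SimpleGraph (Fin n)) : ℕ :=
  widthParam IsTwoSidedKTreeOrd n G

/-- Path-width: the least `k` such that `G` is a subgraph of a `k`-caterpillar. -/
noncomputable def pw (n : ℕ) (G : SimpleGraph (Fin n)) : ℕ :=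
  widthParam IsCaterpillarOrd n G

/-- Proper path-width: the least `k` such that `G` is a subgraph of a linear
`k`-tree. -/
noncomputable def ppw (n : ℕ) (G : SimpleGraph (Fin n)) : ℕ :=
  widthParam IsLinearKTreeOrd n G

/-- `G` has a complete-graph minor on `m` branch sets: there are `m` pairwise
disjoint nonempty connected vertex sets with an edge between every two of them. -/
def HasCliqueMinor {n : ℕ} (G : SimpleGraph (Fin n)) (m : ℕ) : Prop :=
  ∃ B : Fin m → Finset (Fin n),
    (∀ p, (B p).Nonempty) ∧
    (∀ p, (G.induce ((B p : Finset (Fin n)) : Set (Fin n))).Connected) ∧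
    (∀ p q, p ≠ q → Disjoint (B p) (B q)) ∧
    (∀ p q, p ≠ q → ∃ u ∈ B p, ∃ v ∈ B q, G.Adj u v)

/-- The Hadwiger number: the largest `m` such that `K_m` is a minor of `G`. -/
noncomputable def hadwiger (n : ℕ) (G : SimpleGraph (Fin n)) : ℕ :=
  sSup {m | HasCliqueMinor G m}

/-- `A` is a symmetric matrix whose off-diagonal nonzero pattern is the
adjacency of `G`. -/
def DescribesGraph {n : ℕ} (A : Matrix (Fin n) (Fin n) ℝ)
    (G : SimpleGraph (Fin n)) : Prop :=
  A.IsSymm ∧ ∀ i j : Fin n, i ≠ j → (A i j ≠ 0 ↔ G.Adj i j)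

/-- The Strong Arnold Property: the only symmetric `X` with `AX = O`,
`A∘X = O` and `I∘X = O` is `X = O`. -/
def StrongArnold {n : ℕ} (A : Matrix (Fin n) (Fin n) ℝ) : Prop :=
  ∀ X : Matrix (Fin n) (Fin n) ℝ, X.IsSymm → A * X = 0 →
    (∀ i j, A i j * X i j = 0) → (∀ i, X i i = 0) → X = 0

/-- The nullity of a square real matrix. -/
noncomputable def nullity {n : ℕ} (A : Matrix (Fin n) (Fin n) ℝ) : ℕ :=
  Module.finrank ℝ (LinearMap.ker (Matrix.toLin' A))

/-- The Colin de Verdière type parameter `ξ`: maximum nullity of a matrix in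
`S(G)` with the Strong Arnold Property. -/
noncomputable def xiParam (n : ℕ) (G : SimpleGraph (Fin n)) : ℕ :=
  sSup {m | ∃ A : Matrix (Fin n) (Fin n) ℝ,
    DescribesGraph A G ∧ StrongArnold A ∧ nullity A = m}

/-- The Colin de Verdière type parameter `ν`: maximum nullity of a positive
semidefinite matrix in `S(G)` with the Strong Arnold Property. -/
noncomputable def nuParam (n : ℕ) (G : SimpleGraph (Fin n)) : ℕ :=
  sSup {m | ∃ A : Matrix (Fin n) (Fin n) ℝ,
    DescribesGraph A G ∧ A.PosSemidef ∧ StrongArnold A ∧ nullity A = m}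

/-- The Colin de Verdière number `μ`: maximum nullity of a generalized
Laplacian in `S(G)` with exactly one negative eigenvalue and the Strong Arnold
Property. -/
noncomputable def muParam (n : ℕ) (G : SimpleGraph (Fin n)) : ℕ :=
  sSup {m | ∃ (A : Matrix (Fin n) (Fin n) ℝ) (hA : A.IsHermitian),
    DescribesGraph A G ∧ StrongArnold A ∧
    (Finset.univ.filter (fun i => hA.eigenvalues i < 0)).card = 1 ∧
    (∀ i j : Fin n, i ≠ j → A i j ≤ 0) ∧ nullity A = m}

/-- An `r`-decomposition of `K_n`: spanning subgraphs with pairwise disjoint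
edge sets whose union is all of `K_n`. -/
def IsDecomp {n r : ℕ} (G : Fin r → SimpleGraph (Fin n)) : Prop :=
  (∀ i j : Fin r, i ≠ j → Disjoint (G i) (G j)) ∧ (⨆ i, G i) = ⊤

/-- A non-degenerate `r`-decomposition: every part has at least one edge. -/
def IsNDDecomp {n r : ℕ} (G : Fin r → SimpleGraph (Fin n)) : Prop :=
  IsDecomp G ∧ ∀ i, G i ≠ ⊥

/-- Nordhaus–Gaddum sum upper bound `NGΣ↑_β(r;n)`. -/
noncomputable def NGsumUp {n : ℕ} (β : SimpleGraph (Fin n) → ℕ) (r : ℕ) : ℕ :=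
  sSup {s | ∃ G : Fin r → SimpleGraph (Fin n), IsDecomp G ∧ ∑ i, β (G i) = s}

/-- Nordhaus–Gaddum sum lower bound `NGΣ↓_β(r;n)`. -/
noncomputable def NGsumLow {n : ℕ} (β : SimpleGraph (Fin n) → ℕ) (r : ℕ) : ℕ :=
  sInf {s | ∃ G : Fin r → SimpleGraph (Fin n), IsDecomp G ∧ ∑ i, β (G i) = s}

/-- Non-degenerate Nordhaus–Gaddum sum lower bound `NGΣ↓ⁿ_β(r;n)`. -/
noncomputable def NGsumLowND {n : ℕ} (β : SimpleGraph (Fin n) → ℕ) (r : ℕ) : ℕ :=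
  sInf {s | ∃ G : Fin r → SimpleGraph (Fin n), IsNDDecomp G ∧ ∑ i, β (G i) = s}

/-- Nordhaus–Gaddum product upper bound `NGΠ↑_β(r;n)`. -/
noncomputable def NGprodUp {n : ℕ} (β : SimpleGraph (Fin n) → ℕ) (r : ℕ) : ℕ :=
  sSup {s | ∃ G : Fin r → SimpleGraph (Fin n), IsDecomp G ∧ ∏ i, β (G i) = s}

/-- Non-degenerate Nordhaus–Gaddum product upper bound `NGΠ↑ⁿ_β(r;n)`. -/
noncomputable def NGprodUpND {n : ℕ} (β : SimpleGraph (Fin n) → ℕ) (r : ℕ) : ℕ :=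
  sSup {s | ∃ G : Fin r → SimpleGraph (Fin n), IsNDDecomp G ∧ ∏ i, β (G i) = s}

/-- Nordhaus–Gaddum product lower bound `NGΠ↓_β(r;n)`. -/
noncomputable def NGprodLow {n : ℕ} (β : SimpleGraph (Fin n) → ℕ) (r : ℕ) : ℕ :=
  sInf {s | ∃ G : Fin r → SimpleGraph (Fin n), IsDecomp G ∧ ∏ i, β (G i) = s}

/-- Non-degenerate Nordhaus–Gaddum product lower bound `NGΠ↓ⁿ_β(r;n)`. -/
noncomputable def NGprodLowND {n : ℕ} (β : SimpleGraph (Fin n) → ℕ) (r : ℕ) : ℕ :=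
  sInf {s | ∃ G : Fin r → SimpleGraph (Fin n), IsNDDecomp G ∧ ∏ i, β (G i) = s}

/-- The triangular root `t(r) = ⌈√(2r + 1/4) − 1/2⌉`. -/
noncomputable def trt (r : ℕ) : ℕ := ⌈Real.sqrt (2 * (r : ℝ) + 1 / 4) - 1 / 2⌉₊

/-- `H` is a path together with isolated vertices: its edges are exactly those
of a path through some list of distinct vertices. -/
def IsPathGraph {n : ℕ} (H : SimpleGraph (Fin n)) : Prop :=
  ∃ (m : ℕ) (f : Fin (m + 1) ↪ Fin n), ∀ u v : Fin n,
    H.Adj u v ↔ ∃ a b : Fin (m + 1), (a : ℕ) + 1 = (b : ℕ) ∧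
      ((u = f a ∧ v = f b) ∨ (u = f b ∧ v = f a))

end NG

namespace NGaux
open NG

lemma minor_le {n : ℕ} (G : SimpleGraph (Fin n)) (m : ℕ) (h : HasCliqueMinor G m) : m ≤ n := by
  obtain ⟨B, h1, _, h3, _⟩ := h
  choose f hf using h1
  have : Function.Injective f := by
    intro p q hpq
    by_contra hne
    exact Finset.disjoint_left.mp (h3 p q hne) (hf p) (hpq ▸ hf q)
  simpa using Fintype.card_le_of_injective f this

lemma le_hadwiger {n : ℕ} (G : SimpleGraph (Fin n)) (m : ℕ) (h : HasCliqueMinor G m) :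
    m ≤ hadwiger n G :=
  le_csSup ⟨n, fun k hk => minor_le G k hk⟩ h

lemma hadwiger_le {n : ℕ} (G : SimpleGraph (Fin n)) : hadwiger n G ≤ n := by
  apply csSup_le'
  exact fun k hk => minor_le G k hk

lemma clique_minor {n m : ℕ} (G : SimpleGraph (Fin n)) (f : Fin m → Fin n)
    (hf : Function.Injective f) (h : ∀ p q, p ≠ q → G.Adj (f p) (f q)) : HasCliqueMinor G m := by
  refine ⟨fun p => {f p}, by simp, ?_, ?_, ?_⟩
  · intro p
    rw [Finset.coe_singleton]
    exact SimpleGraph.Connected.mk SimpleGraph.Preconnected.of_subsingleton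
  · intro p q hpq
    simpa using fun h => hpq (hf h)
  · intro p q hpq
    simpa using h p q hpq

lemma bip_minor {n m : ℕ} (G : SimpleGraph (Fin n)) (x y : Fin (m+1) → Fin n)
    (hx : Function.Injective x) (hy : Function.Injective y)
    (hxy : ∀ p q, x p ≠ y q) (h : ∀ p q, G.Adj (x p) (y q)) : HasCliqueMinor G (m+2) := by
  let a : Fin (m+2) → Fin n := fun p => if hp : (p : ℕ) ≤ m then x ⟨p, by omega⟩ else y (Fin.last m)
  let b : Fin (m+2) → Fin n := fun p => if hp : (p : ℕ) < m then y ⟨p, by omega⟩ else a p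
  refine ⟨fun p => {a p, b p}, by simp, ?_, ?_, ?_⟩
  · intro p
    rw [Finset.coe_insert, Finset.coe_singleton]
    by_cases hp : (p : ℕ) < m
    · apply SimpleGraph.induce_pair_connected_of_adj
      simp only [a, b, hp, hp.le, dif_pos]
      exact h _ _
    · have : b p = a p := by simp only [b, hp, dif_neg, not_false_eq_true]
      rw [this, Set.pair_eq_singleton]
      exact SimpleGraph.Connected.mk SimpleGraph.Preconnected.of_subsingleton
  · intro p q hpq
    have hv : (p : ℕ) ≠ q := fun h => hpq (Fin.ext h)
    have hp := p.2
    have hq := q.2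
    rw [Finset.disjoint_left]
    intro u hu hu'
    simp only [Finset.mem_insert, Finset.mem_singleton] at hu hu'
    have key : ∀ w, w = a p ∨ w = b p → w = a q ∨ w = b q → False := by
      intro w h1 h2
      simp only [a, b] at h1 h2
      rcases h1 with h1 | h1 <;> rcases h2 with h2 | h2 <;> split_ifs at h1 h2 <;>
      · rw [h1] at h2
        first
          | exact hxy _ _ h2
          | exact hxy _ _ h2.symm
          | (have h3 := congrArg Fin.val (hx h2); simp at h3; omega)
          | (have h3 := congrArg Fin.val (hy h2); simp at h3; omega)
          | omega
    exact key u hu hu'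
  · have key : ∀ p q : Fin (m+2), (p : ℕ) < q →
        ∃ u ∈ ({a p, b p} : Finset (Fin n)), ∃ v ∈ ({a q, b q} : Finset (Fin n)), G.Adj u v := by
      intro p q hpq
      have hq := q.2
      by_cases hq' : (q : ℕ) ≤ m
      · refine ⟨b p, by simp, a q, by simp, ?_⟩
        have hp : (p : ℕ) < m := by omega
        simp only [a, b, hp, hq', dif_pos]
        exact (h _ _).symm
      · refine ⟨a p, by simp, a q, by simp, ?_⟩
        have hp : (p : ℕ) ≤ m := by omega
        simp only [a, hp, hq', dif_pos, dif_neg, not_false_eq_true]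
        exact h _ _
    intro p q hpq
    rcases lt_or_gt_of_ne (fun h => hpq (Fin.ext h) : (p : ℕ) ≠ q) with h1 | h1
    · exact key p q h1
    · obtain ⟨u, hu, v, hv, huv⟩ := key q p h1
      exact ⟨v, hv, u, hu, huv.symm⟩

def colG {t s r : ℕ} (c : Sym2 (Fin t) → Fin r) (i : Fin r) : SimpleGraph (Fin (t * s)) where
  Adj u v := u ≠ v ∧
    c s((finProdFinEquiv.symm u).1, (finProdFinEquiv.symm v).1) = i
  symm := ⟨fun u v h => ⟨h.1.symm, by rw [Sym2.eq_swap]; exact h.2⟩⟩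
  loopless := ⟨fun u h => h.1 rfl⟩

lemma colG_decomp {t s r : ℕ} (c : Sym2 (Fin t) → Fin r) :
    IsDecomp (fun i => colG (s := s) c i) := by
  constructor
  · intro i j hij
    rw [disjoint_iff]
    ext u v
    simp only [SimpleGraph.inf_adj, SimpleGraph.bot_adj, iff_false, colG]
    rintro ⟨h1, h2⟩
    exact hij (h1.2.symm.trans h2.2)
  · ext u v
    simp [SimpleGraph.iSup_adj, colG]

lemma colG_had {t s r : ℕ} (hs : 1 ≤ s) (c : Sym2 (Fin t) → Fin r) (e : Sym2 (Fin t)) :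
    s + 1 ≤ hadwiger (t * s) (colG c (c e)) + (if e.IsDiag then 1 else 0) := by
  obtain ⟨m, rfl⟩ : ∃ m, s = m + 1 := ⟨s - 1, by omega⟩
  induction e using Sym2.ind with
  | _ a b =>
  split_ifs with hd
  · have hab : a = b := by simpa using hd
    subst hab
    apply Nat.succ_le_succ
    apply le_hadwiger
    apply clique_minor _ (fun k => finProdFinEquiv (a, k))
    · intro p q h
      simpa using h
    · intro p q h
      refine ⟨by simpa using h, ?_⟩
      simp only [Equiv.symm_apply_apply]
  · have hab : a ≠ b := by simpa using hd
    apply le_hadwiger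
    apply bip_minor _ (fun k => finProdFinEquiv (a, k)) (fun k => finProdFinEquiv (b, k))
    · intro p q h
      simpa using h
    · intro p q h
      simpa using h
    · intro p q
      simp [hab]
    · intro p q
      refine ⟨by simp [hab], ?_⟩
      simp only [Equiv.symm_apply_apply]

lemma main {t s r : ℕ} (hs : 1 ≤ s) (ht : t ≤ r) (hr : 2 * r ≤ t * (t + 1)) (hr0 : 0 < r) :
    r * (s + 1) ≤ NGsumUp (hadwiger (t * s)) r + t := by
  have hD : (Finset.univ.filter (fun e : Sym2 (Fin t) => e.IsDiag)).card = t := by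
    have := Sym2.card_subtype_diag (α := Fin t)
    rw [Fintype.card_subtype] at this
    simpa using this
  have hU : r ≤ (Finset.univ : Finset (Sym2 (Fin t))).card := by
    rw [Finset.card_univ, Sym2.card, Fintype.card_fin, Nat.choose_two_right]
    rw [Nat.le_div_iff_mul_le (by norm_num)]
    simp only [Nat.add_sub_cancel]
    linarith
  obtain ⟨S, hDS, -, hS⟩ := Finset.exists_subsuperset_card_eq
    (Finset.subset_univ (Finset.univ.filter (fun e : Sym2 (Fin t) => e.IsDiag))) (hD.le.trans ht) hU
  let E : S ≃ Fin r := S.equivFinOfCardEq hS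
  let c : Sym2 (Fin t) → Fin r := fun e => if h : e ∈ S then E ⟨e, h⟩ else ⟨0, hr0⟩
  have hc : ∀ e : S, c e = E e := fun e => by simp [c]
  have h1 : ∑ i, hadwiger (t * s) (colG c i) ≤ NGsumUp (hadwiger (t * s)) r := by
    apply le_csSup
    · refine ⟨r * (t * s), ?_⟩
      rintro _ ⟨G, -, rfl⟩
      calc _ ≤ ∑ i : Fin r, t * s := Finset.sum_le_sum fun i _ => hadwiger_le _
        _ = _ := by simp
    · exact ⟨_, colG_decomp c, rfl⟩
  have h2 : ∑ i, hadwiger (t * s) (colG c i) = ∑ e ∈ S, hadwiger (t * s) (colG c (c e)) := by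
    rw [← Finset.sum_coe_sort S, ← E.sum_comp]
    simp only [hc]
  have h3 : ∑ e ∈ S, (if e.IsDiag then 1 else 0) = t := by
    rw [← Finset.card_filter]
    refine Eq.trans ?_ hD
    congr 1
    ext e
    simp only [Finset.mem_filter, Finset.mem_univ, true_and, and_iff_right_iff_imp]
    exact fun he => hDS (by simpa using he)
  have h4 : ∑ e ∈ S, (s + 1) ≤
      ∑ e ∈ S, (hadwiger (t * s) (colG c (c e)) + (if e.IsDiag then 1 else 0)) :=
    Finset.sum_le_sum fun e _ => colG_had hs c e
  rw [Finset.sum_const, hS, smul_eq_mul, Finset.sum_add_distrib, h3, ← h2] at h4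
  omega

lemma trt_bounds (r : ℕ) (hr : 1 ≤ r) : trt r ≤ r ∧ 2 * r ≤ trt r * (trt r + 1) := by
  have hr' : (1 : ℝ) ≤ r := by exact_mod_cast hr
  constructor
  · unfold trt
    rw [Nat.ceil_le, sub_le_iff_le_add, Real.sqrt_le_left (by positivity)]
    nlinarith
  · have h : Real.sqrt (2 * (r : ℝ) + 1 / 4) - 1 / 2 ≤ (trt r : ℝ) := Nat.le_ceil _
    rw [sub_le_iff_le_add, Real.sqrt_le_left (by positivity)] at h
    have : (2 * r : ℝ) ≤ trt r * (trt r + 1) := by nlinarith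
    exact_mod_cast this

end NGaux

/-- For fixed `r ≥ 2`, `t = ⌈√(2r+1/4) − 1/2⌉`, every `s ≥ 1` and `n = ts`:
`(r/t)·n + (r − t) ≤ NGΣ↑_η(r;n)`. -/
theorem statement2 (r : ℕ) (hr : 2 ≤ r) (t : ℕ) (ht : t = NG.trt r)
    (s : ℕ) (hs : 1 ≤ s) :
    (r : ℝ) / t * ((t * s : ℕ) : ℝ) + ((r : ℝ) - t) ≤
      NG.NGsumUp (NG.hadwiger (t * s)) r := by
  obtain ⟨h1, h2⟩ := NGaux.trt_bounds r (by omega)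
  rw [← ht] at h1 h2
  have h3 := NGaux.main hs h1 h2 (by omega)
  have ht0 : (t : ℝ) ≠ 0 := by
    rintro h
    have : t = 0 := by exact_mod_cast h
    subst this
    omega
  have h4 : (r : ℝ) * (s + 1) ≤ NG.NGsumUp (NG.hadwiger (t * s)) r + t := by exact_mod_cast h3
  have h5 : (r : ℝ) / t * ((t * s : ℕ) : ℝ) = r * s := by
    push_cast
    field_simp
  rw [h5]
  linarith
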